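/- (Proposition 1, lower bound: L_RSM ≤ L_ASM.) It holds that −1/τ + E[ log( e^{1/τ} + Σ_{i=1}^M e^{⟨f(X), f(Yᵢ⁻)⟩/τ} ) ] ≤ E[ −log( e^{⟨f(X),f(Y)⟩/τ} / ( e^{⟨f(X),f(Y)⟩/τ} + Σ_{i=1}^M e^{⟨f(X), f(Yᵢ⁻)⟩/τ} ) ) ], i.e. the relative similarity metric loss L_RSM is a lower bound for the absolute similarity metric (NCE) loss L_ASM. -/

import Mathlib

open MeasureTheory RealInnerProductSpace

/-- The log-sum-exp of finitely many bounded measurable functions is integrable on a finite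
measure space. -/
lemma integrable_log_exp_add_sum_exp {Ω ι : Type*} [Fintype ι] [MeasurableSpace Ω]
    {μ : Measure Ω} [IsFiniteMeasure μ] {C : ℝ} {a : Ω → ℝ} {b : ι → Ω → ℝ}
    (ha : Measurable a) (hb : ∀ i, Measurable (b i))
    (haC : ∀ ω, |a ω| ≤ C) (hbC : ∀ i ω, b i ω ≤ C) :
    Integrable (fun ω => Real.log (Real.exp (a ω) + ∑ i, Real.exp (b i ω))) μ := by
  have hmeas : Measurable (fun ω => Real.log (Real.exp (a ω) + ∑ i, Real.exp (b i ω))) := by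
    fun_prop
  refine Integrable.of_bound hmeas.aestronglyMeasurable
    (Real.log (1 + Fintype.card ι) + C) (Filter.Eventually.of_forall fun ω => ?_)
  have hsum : 0 ≤ ∑ i, Real.exp (b i ω) := Finset.sum_nonneg fun i _ => (Real.exp_pos _).le
  have hsum_le : ∑ i, Real.exp (b i ω) ≤ Fintype.card ι * Real.exp C := by
    simpa using Finset.sum_le_card_nsmul Finset.univ (fun i => Real.exp (b i ω)) (Real.exp C)
      fun i _ => Real.exp_le_exp.2 (hbC i ω)
  have hcard : (0 : ℝ) ≤ Fintype.card ι := Nat.cast_nonneg _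
  have hlog : 0 ≤ Real.log (1 + Fintype.card ι) := Real.log_nonneg (by linarith)
  obtain ⟨hlow, hup⟩ := abs_le.1 (haC ω)
  have hpos : 0 < Real.exp (a ω) + ∑ i, Real.exp (b i ω) := by positivity
  rw [Real.norm_eq_abs, abs_le]
  constructor
  · have : a ω ≤ Real.log (Real.exp (a ω) + ∑ i, Real.exp (b i ω)) :=
      (Real.le_log_iff_exp_le hpos).2 (by linarith)
    linarith
  · rw [Real.log_le_iff_le_exp hpos, Real.exp_add, Real.exp_log (by linarith)]
    have := Real.exp_le_exp.2 hup
    linarith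

/-- For `0 ≤ s`, the function `a ↦ log (exp a + s) - a` is antitone. -/
lemma log_exp_add_sub_le {a b s : ℝ} (hab : a ≤ b) (hs : 0 ≤ s) :
    Real.log (Real.exp b + s) - b ≤ Real.log (Real.exp a + s) - a := by
  have key : Real.exp b + s ≤ Real.exp (b - a) * (Real.exp a + s) := by
    have hone : 1 ≤ Real.exp (b - a) := Real.one_le_exp (by linarith)
    have hmul : Real.exp (b - a) * Real.exp a = Real.exp b := by
      rw [← Real.exp_add, sub_add_cancel]
    nlinarith
  have hlog := Real.log_le_log (by positivity) key
  rw [Real.log_mul (Real.exp_pos _).ne' (by positivity), Real.log_exp] at hlog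
  linarith

/-- Proposition 1, lower bound: the relative similarity metric loss `L_RSM` is a
lower bound for the absolute similarity metric (NCE) loss `L_ASM`. -/
theorem stmt_1 {n d : ℕ} (τ : ℝ) (hτ : 0 < τ) (M : ℕ) (hM : 0 < M)
    {Ω : Type*} [MeasurableSpace Ω] (μ : Measure Ω) [IsProbabilityMeasure μ]
    (f : EuclideanSpace ℝ (Fin n) → EuclideanSpace ℝ (Fin d))
    (hf : Measurable f) (hfnorm : ∀ v, ‖f v‖ = 1)
    (X Y : Ω → EuclideanSpace ℝ (Fin n)) (hX : Measurable X) (hY : Measurable Y)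
    (Yneg : Fin M → Ω → EuclideanSpace ℝ (Fin n)) (hYneg : ∀ i, Measurable (Yneg i)) :
    -(1 / τ) +
      ∫ ω, Real.log (Real.exp (1 / τ) +
        ∑ i : Fin M, Real.exp (⟪f (X ω), f (Yneg i ω)⟫ / τ)) ∂μ
    ≤ ∫ ω, -Real.log (Real.exp (⟪f (X ω), f (Y ω)⟫ / τ) /
        (Real.exp (⟪f (X ω), f (Y ω)⟫ / τ) +
          ∑ i : Fin M, Real.exp (⟪f (X ω), f (Yneg i ω)⟫ / τ))) ∂μ := by
  have hinner : ∀ u v, |⟪f u, f v⟫ / τ| ≤ 1 / τ := fun u v => by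
    rw [abs_div, abs_of_pos hτ]
    gcongr
    simpa [hfnorm] using abs_real_inner_le_norm (f u) (f v)
  have ha : Measurable fun ω => ⟪f (X ω), f (Y ω)⟫ / τ :=
    ((hf.comp hX).inner (hf.comp hY)).div_const τ
  have hb : ∀ i, Measurable fun ω => ⟪f (X ω), f (Yneg i ω)⟫ / τ := fun i =>
    ((hf.comp hX).inner (hf.comp (hYneg i))).div_const τ
  have hbC : ∀ i ω, ⟪f (X ω), f (Yneg i ω)⟫ / τ ≤ 1 / τ := fun i ω =>
    (le_abs_self _).trans (hinner _ _)
  have hasm : ∀ ω, -Real.log (Real.exp (⟪f (X ω), f (Y ω)⟫ / τ) /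
        (Real.exp (⟪f (X ω), f (Y ω)⟫ / τ) +
          ∑ i : Fin M, Real.exp (⟪f (X ω), f (Yneg i ω)⟫ / τ))) =
      Real.log (Real.exp (⟪f (X ω), f (Y ω)⟫ / τ) +
        ∑ i : Fin M, Real.exp (⟪f (X ω), f (Yneg i ω)⟫ / τ)) - ⟪f (X ω), f (Y ω)⟫ / τ := by
    intro ω
    rw [Real.log_div (Real.exp_pos _).ne' (by positivity), Real.log_exp, neg_sub]
  simp_rw [hasm]
  have hrsm_int : Integrable (fun ω => Real.log (Real.exp (1 / τ) +
      ∑ i : Fin M, Real.exp (⟪f (X ω), f (Yneg i ω)⟫ / τ))) μ :=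
    integrable_log_exp_add_sum_exp measurable_const hb
      (fun _ => (abs_of_pos (one_div_pos.2 hτ)).le) hbC
  have ha_int : Integrable (fun ω => ⟪f (X ω), f (Y ω)⟫ / τ) μ :=
    Integrable.of_bound ha.aestronglyMeasurable (1 / τ)
      (Filter.Eventually.of_forall fun ω => hinner _ _)
  have hasm_int := (integrable_log_exp_add_sum_exp (μ := μ) ha hb
    (fun ω => hinner _ _) hbC).sub ha_int
  calc _ = ∫ ω, (Real.log (Real.exp (1 / τ) +
        ∑ i : Fin M, Real.exp (⟪f (X ω), f (Yneg i ω)⟫ / τ)) - 1 / τ) ∂μ := by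
        rw [integral_sub hrsm_int (integrable_const _), integral_const, probReal_univ, one_smul]
        ring
    _ ≤ _ := integral_mono (hrsm_int.sub (integrable_const _)) hasm_int fun ω =>
        log_exp_add_sub_le ((le_abs_self _).trans (hinner _ _))
          (Finset.sum_nonneg fun i _ => (Real.exp_pos _).le)
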